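/- Let λ : ℤ → ℝ and w : ℤ → ℝ∖{0} satisfy the convergence condition for at least one z₀ ∈ ℂ₀^λ, and assume der(λ) ≠ ℝ. Then every zero of F_𝒥 in ℂ₀^λ is real and simple; that is, if z₀ ∈ ℂ₀^λ and F_𝒥(z₀) = 0, then z₀ ∈ ℝ and F_𝒥'(z₀) ≠ 0. -/

import Mathlib

open Filter Topology
open scoped Classical

noncomputable section

namespace Jacobi

/-- Admissible index tuples `k : Fin (m+1) → ℤ` with gaps `≥ 2` (an `(m+1)`-tuple,
corresponding to the `m`-th summand, `m ≥ 1`, in the paper). -/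
def Tup (m : ℕ) : Type :=
  {k : Fin (m + 1) → ℤ // ∀ j : Fin m, k j.castSucc + 2 ≤ k j.succ}

/-- The function `𝔉` of Stampach--Stovicek. -/
def FF (x : ℤ → ℂ) : ℂ :=
  1 + ∑' m : ℕ, (-1 : ℂ) ^ (m + 1) * ∑' k : Tup m, ∏ j, x (k.1 j) * x (k.1 j + 1)

/-- `𝔉` applied to the restriction of `x` to `s` (extension by zeros). -/
def FFon (s : Set ℤ) (x : ℤ → ℂ) : ℂ := FF (s.indicator x)

/-- `ℂ₀^λ`. -/
def C0 (lam : ℤ → ℂ) : Set ℂ := (closure (Set.range lam))ᶜ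

/-- `der λ`: the set of (finite) accumulation points of the sequence `λ`. -/
def der (lam : ℤ → ℂ) : Set ℂ := {z | MapClusterPt z Filter.cofinite lam}

/-- The basic convergence condition (at one point of `ℂ₀^λ`). -/
def ConvCond (lam w : ℤ → ℂ) : Prop :=
  ∃ z₀ ∈ C0 lam, Summable fun n : ℤ => ‖w n ^ 2 / ((lam n - z₀) * (lam (n + 1) - z₀))‖

/-- The characteristic function `F_𝒥`. -/
def charF (lam γ : ℤ → ℂ) (z : ℂ) : ℂ := FF fun n => γ n ^ 2 / (z - lam n)

/-- `r(z)`. -/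
def rz (lam : ℤ → ℂ) (z : ℂ) : ℕ := Set.ncard {n : ℤ | lam n = z}

/-- `r₊(z)`. -/
def rp (lam : ℤ → ℂ) (z : ℂ) : ℕ := Set.ncard {n : ℤ | 0 < n ∧ lam n = z}

/-- `r₋(z)`. -/
def rm (lam : ℤ → ℂ) (z : ℂ) : ℕ := Set.ncard {n : ℤ | n ≤ 0 ∧ lam n = z}

/-- `𝒫_n(z)`. -/
def Pz (lam w : ℤ → ℂ) (z : ℂ) (n : ℤ) : ℂ :=
  if 0 ≤ n then ∏ k ∈ Finset.Icc (1 : ℤ) n, w (k - 1) / (z - lam k)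
  else ∏ k ∈ Finset.Icc (n + 1) (0 : ℤ), (z - lam k) / w (k - 1)

/-- `𝔉((γ_k²/(λ_k − z))_{k=n}^{∞})`. -/
def Fplus (lam γ : ℤ → ℂ) (z : ℂ) (n : ℤ) : ℂ :=
  FFon {k | n ≤ k} fun k => γ k ^ 2 / (lam k - z)

/-- `𝔉((γ_k²/(λ_k − z))_{k=−∞}^{n})`. -/
def Fminus (lam γ : ℤ → ℂ) (z : ℂ) (n : ℤ) : ℂ :=
  FFon {k | k ≤ n} fun k => γ k ^ 2 / (lam k - z)

/-- `f_n(z)` for `z ∈ ℂ₀^λ`. -/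
def fSol₀ (lam w γ : ℤ → ℂ) (z : ℂ) (n : ℤ) : ℂ :=
  Pz lam w z n * Fplus lam γ z (n + 1)

/-- `g_n(z)` for `z ∈ ℂ₀^λ`. -/
def gSol₀ (lam w γ : ℤ → ℂ) (z : ℂ) (n : ℤ) : ℂ :=
  (w (n - 1) * Pz lam w z (n - 1))⁻¹ * Fminus lam γ z (n - 1)

/-- `f_n(z)` extended to `ℂ ∖ der λ` by the limit formula. -/
def fSol (lam w γ : ℤ → ℂ) (z : ℂ) (n : ℤ) : ℂ :=
  if z ∈ C0 lam then fSol₀ lam w γ z n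
  else limUnder (𝓝[C0 lam] z) fun u => (u - z) ^ rp lam z * fSol₀ lam w γ u n

/-- `g_n(z)` extended to `ℂ ∖ der λ` by the limit formula. -/
def gSol (lam w γ : ℤ → ℂ) (z : ℂ) (n : ℤ) : ℂ :=
  if z ∈ C0 lam then gSol₀ lam w γ z n
  else limUnder (𝓝[C0 lam] z) fun u => (u - z) ^ rm lam z * gSol₀ lam w γ u n

/-- The extended zero set `𝔷(𝒥)` of the characteristic function. -/
def Zset (lam w γ : ℤ → ℂ) : Set ℂ :=
  {z | z ∉ der lam ∧
    Tendsto (fun u => (u - z) ^ rz lam z * charF lam γ u) (𝓝[C0 lam] z) (𝓝 0)}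

/-- The Hilbert space `ℓ²(ℤ)`. -/
abbrev ℓ2 : Type := lp (fun _ : ℤ => ℂ) 2

/-- The formal Jacobi matrix acting on sequences. -/
def Jop (lam w : ℤ → ℂ) (u : ℤ → ℂ) : ℤ → ℂ := fun n =>
  w (n - 1) * u (n - 1) + lam n * u n + w n * u (n + 1)

lemma Jop_add (lam w : ℤ → ℂ) (u v : ℤ → ℂ) :
    Jop lam w (u + v) = Jop lam w u + Jop lam w v := by
  funext n; simp [Jop]; ring

lemma Jop_smul (lam w : ℤ → ℂ) (c : ℂ) (u : ℤ → ℂ) :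
    Jop lam w (c • u) = c • Jop lam w u := by
  funext n; simp [Jop]; ring

/-- The domain of the maximal operator. -/
def JmaxDom (lam w : ℤ → ℂ) : Submodule ℂ ℓ2 where
  carrier := {x | Memℓp (Jop lam w ⇑x) 2}
  add_mem' := by
    intro x y hx hy
    show Memℓp (Jop lam w ⇑(x + y)) 2
    rw [lp.coeFn_add, Jop_add]
    exact hx.add hy
  zero_mem' := by
    show Memℓp (Jop lam w ⇑(0 : ℓ2)) 2
    have h0 : Jop lam w ⇑(0 : ℓ2) = 0 := by
      funext n; simp [Jop, lp.coeFn_zero]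
    rw [h0]
    exact zero_memℓp
  smul_mem' := by
    intro c x hx
    show Memℓp (Jop lam w ⇑(c • x)) 2
    rw [lp.coeFn_smul, Jop_smul]
    exact hx.const_smul c

/-- The maximal operator `J_max` as a partially defined linear operator on `ℓ²(ℤ)`. -/
def Jmax (lam w : ℤ → ℂ) : ℓ2 →ₗ.[ℂ] ℓ2 where
  domain := JmaxDom lam w
  toFun :=
    { toFun := fun x => (⟨Jop lam w ⇑(x : ℓ2), x.2⟩ : ℓ2)
      map_add' := by
        intro x y
        apply lp.ext
        rw [lp.coeFn_add]
        show Jop lam w ⇑((x : ℓ2) + (y : ℓ2)) = Jop lam w ⇑(x : ℓ2) + Jop lam w ⇑(y : ℓ2)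
        rw [lp.coeFn_add, Jop_add]
      map_smul' := by
        intro c x
        apply lp.ext
        rw [lp.coeFn_smul]
        show Jop lam w ⇑(c • (x : ℓ2)) = c • Jop lam w ⇑(x : ℓ2)
        rw [lp.coeFn_smul, Jop_smul] }

/-- The standard basis vector `e n` in `ℓ²(ℤ)`. -/
def eVec (n : ℤ) : ℓ2 := lp.single 2 n (1 : ℂ)

/-- The span of the standard basis vectors. -/
def stdSpan : Submodule ℂ ℓ2 := Submodule.span ℂ (Set.range eVec)

/-- The minimal operator `J_min`: the closure of the restriction of `𝒥` to the span of the
standard basis. -/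
def Jmin (lam w : ℤ → ℂ) : ℓ2 →ₗ.[ℂ] ℓ2 :=
  ((Jmax lam w).domRestrict stdSpan).closure

/-- `z` is an eigenvalue of the partially defined operator `T`. -/
def IsEV (T : ℓ2 →ₗ.[ℂ] ℓ2) (z : ℂ) : Prop :=
  ∃ x : T.domain, (x : ℓ2) ≠ 0 ∧ T x = z • (x : ℓ2)

/-- `z` belongs to the resolvent set of `T`: `T - z` is a bijection of `Dom T` onto `ℓ²(ℤ)`
with bounded (continuous linear) inverse. -/
def InRes (T : ℓ2 →ₗ.[ℂ] ℓ2) (z : ℂ) : Prop :=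
  ∃ R : ℓ2 →L[ℂ] ℓ2,
    (∀ x : T.domain, R (T x - z • (x : ℓ2)) = x) ∧
    ∀ y : ℓ2, ∃ hy : R y ∈ T.domain, T ⟨R y, hy⟩ - z • (R y) = y

/-- The spectrum of a partially defined operator. -/
def Spec (T : ℓ2 →ₗ.[ℂ] ℓ2) : Set ℂ := {z | ¬ InRes T z}

/-- `Ker (T - z)^n`. -/
def iterKer (T : ℓ2 →ₗ.[ℂ] ℓ2) (z : ℂ) : ℕ → Set ℓ2
  | 0 => {0}
  | n + 1 => {x | ∃ hx : x ∈ T.domain, ((T ⟨x, hx⟩ : ℓ2) - z • x) ∈ iterKer T z n}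

/-- The set of generalized eigenvectors of `T` at `z`. -/
def genEig (T : ℓ2 →ₗ.[ℂ] ℓ2) (z : ℂ) : Set ℓ2 :=
  {x | ∃ n : ℕ, x ∈ iterKer T z n}

/-- `Φ_p^+`. -/
def PhiP (lam : ℤ → ℂ) (p : ℕ) (z : ℂ) : ℂ :=
  ∏' n : ℕ, ((1 - lam ((n : ℤ) + 1) / z) *
    Complex.exp (∑ j ∈ Finset.Icc 1 (p - 1), (lam ((n : ℤ) + 1) / z) ^ j / (j : ℂ)))

/-- `Φ_p^-`. -/
def PhiM (lam : ℤ → ℂ) (p : ℕ) (z : ℂ) : ℂ :=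
  ∏' n : ℕ, ((1 - lam (-(n : ℤ)) / z) *
    Complex.exp (∑ j ∈ Finset.Icc 1 (p - 1), (lam (-(n : ℤ)) / z) ^ j / (j : ℂ)))

/-- `Ψ_p^+`. -/
def PsiP (lam : ℤ → ℂ) (p : ℕ) (z : ℂ) : ℂ :=
  ∏' n : ℕ, ((1 - z / lam ((n : ℤ) + 1)) *
    Complex.exp (∑ j ∈ Finset.Icc 1 (p - 1), (z / lam ((n : ℤ) + 1)) ^ j / (j : ℂ)))

/-- `Ψ_p^-`. -/
def PsiM (lam : ℤ → ℂ) (p : ℕ) (z : ℂ) : ℂ :=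
  ∏' n : ℕ, ((1 - z / lam (-(n : ℤ))) *
    Complex.exp (∑ j ∈ Finset.Icc 1 (p - 1), (z / lam (-(n : ℤ))) ^ j / (j : ℂ)))

end Jacobi

namespace Jacobi

/-- No two consecutive integers. -/
def Sparse (S : Finset ℤ) : Prop := ∀ k ∈ S, k + 1 ∉ S

/-- A single term. -/
def TT (a : ℤ → ℂ) (s : Set ℤ) (S : Finset ℤ) : ℂ :=
  if Sparse S ∧ (∀ k ∈ S, k ∈ s) then ∏ k ∈ S, (-a k) else 0

/-- The sum over sparse finite subsets of `s`. -/
def PP (a : ℤ → ℂ) (s : Set ℤ) : ℂ := ∑' S : Finset ℤ, TT a s S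

lemma TT_norm_le (a : ℤ → ℂ) (s : Set ℤ) (S : Finset ℤ) :
    ‖TT a s S‖ ≤ ∏ k ∈ S, ‖a k‖ := by
  unfold TT
  split_ifs
  · simp [norm_prod]
  · simpa using Finset.prod_nonneg fun i _ => norm_nonneg _

lemma TT_summable {a : ℤ → ℂ} (ha : Summable fun n => ‖a n‖) (s : Set ℤ) :
    Summable (TT a s) :=
  (summable_finsetProd_of_summable_nonneg (fun _ => norm_nonneg _) ha).of_norm_bounded
    (TT_norm_le a s)

lemma PP_tendsto {ι : Type*} {l : Filter ι} {a : ℤ → ℂ} (ha : Summable fun n => ‖a n‖)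
    (s : ι → Set ℤ) (t : Set ℤ) (h : ∀ k, ∀ᶠ i in l, (k ∈ s i ↔ k ∈ t)) :
    Tendsto (fun i => PP a (s i)) l (𝓝 (PP a t)) := by
  unfold PP
  refine tendsto_tsum_of_dominated_convergence
    (summable_finsetProd_of_summable_nonneg (fun _ => norm_nonneg _) ha) ?_
    (Eventually.of_forall fun i S => TT_norm_le a (s i) S)
  intro S
  apply tendsto_const_nhds.congr'
  have : ∀ᶠ i in l, ∀ k ∈ S, (k ∈ s i ↔ k ∈ t) := (Filter.eventually_all_finset S).2 fun k _ => h k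
  filter_upwards [this] with i hi
  unfold TT
  have : (∀ k ∈ S, k ∈ s i) ↔ (∀ k ∈ S, k ∈ t) := forall₂_congr hi
  simp only [this]

lemma PP_empty (a : ℤ → ℂ) : PP a ∅ = 1 := by
  unfold PP
  rw [tsum_eq_single ∅]
  · simp [TT, Sparse]
  · intro S hS
    obtain ⟨k, hk⟩ := Finset.nonempty_iff_ne_empty.2 hS
    unfold TT
    rw [if_neg]
    rintro ⟨_, h⟩
    exact h k hk

/-- Toggle membership of `j`. -/
def toggle (j : ℤ) : Finset ℤ ≃ Finset ℤ where
  toFun S := if j ∈ S then S.erase j else insert j S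
  invFun S := if j ∈ S then S.erase j else insert j S
  left_inv S := by
    by_cases h : j ∈ S <;> simp [h]
  right_inv S := by
    by_cases h : j ∈ S <;> simp [h]

lemma PP_rec {a : ℤ → ℂ} (ha : Summable fun n => ‖a n‖) {s t u : Set ℤ} {j : ℤ} (hj : j ∈ s)
    (ht : ∀ k, k ∈ t ↔ k ∈ s ∧ k ≠ j)
    (hu : ∀ k, k ∈ u ↔ k ∈ s ∧ k ≠ j ∧ k ≠ j + 1 ∧ k ≠ j - 1) :
    PP a s = PP a t - a j * PP a u := by
  have h1 : ∀ S, TT a s S = TT a t S + (if j ∈ S then TT a s S else 0) := by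
    intro S
    by_cases h : j ∈ S
    · have : TT a t S = 0 := by
        unfold TT
        rw [if_neg]
        rintro ⟨_, h'⟩
        exact ((ht j).1 (h' j h)).2 rfl
      simp [h, this]
    · have : (∀ k ∈ S, k ∈ s) ↔ (∀ k ∈ S, k ∈ t) := by
        refine forall₂_congr fun k hk => ?_
        rw [ht]
        have : k ≠ j := fun e => h (e ▸ hk)
        simp [this]
      simp [h, TT, this]
  have h2 : ∀ S, (if j ∈ toggle j S then TT a s (toggle j S) else 0) = - a j * TT a u S := by
    intro S
    by_cases h : j ∈ S
    · have : TT a u S = 0 := by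
        unfold TT
        rw [if_neg]
        rintro ⟨_, h'⟩
        exact ((hu j).1 (h' j h)).2.1 rfl
      simp [toggle, h, this]
    · have e : toggle j S = insert j S := by simp [toggle, h]
      rw [e]
      simp only [Finset.mem_insert_self, if_true]
      have : (Sparse (insert j S) ∧ ∀ k ∈ insert j S, k ∈ s) ↔ (Sparse S ∧ ∀ k ∈ S, k ∈ u) := by
        constructor
        · rintro ⟨h1, h2⟩
          refine ⟨fun k hk hk' => h1 k (Finset.mem_insert_of_mem hk) (Finset.mem_insert_of_mem hk'),
            fun k hk => (hu k).2 ⟨h2 k (Finset.mem_insert_of_mem hk), fun e => h (e ▸ hk),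
              fun e => ?_, fun e => ?_⟩⟩
          · exact h1 j (Finset.mem_insert_self _ _) (Finset.mem_insert_of_mem (e ▸ hk))
          · exact h1 k (Finset.mem_insert_of_mem hk) (by rw [e]; simp)
        · rintro ⟨h1, h2⟩
          refine ⟨fun k hk hk' => ?_, fun k hk => ?_⟩
          · rw [Finset.mem_insert] at hk hk'
            rcases hk with hk | hk <;> rcases hk' with hk' | hk'
            · omega
            · have := (hu _).1 (h2 _ hk'); rw [hk] at this; exact this.2.2.1 rfl
            · have := (hu _).1 (h2 _ hk); omega
            · exact h1 k hk hk'
          · rw [Finset.mem_insert] at hk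
            rcases hk with hk | hk
            · rwa [hk]
            · exact ((hu _).1 (h2 _ hk)).1
      unfold TT
      simp only [this]
      split_ifs
      · rw [Finset.prod_insert h]
      · simp
  have hs2 : Summable fun S => (if j ∈ S then TT a s S else 0) := by
    have := (TT_summable ha s).sub (TT_summable ha t)
    refine this.congr fun S => ?_
    exact sub_eq_of_eq_add' (h1 S)
  unfold PP
  rw [tsum_congr h1, (TT_summable ha t).tsum_add hs2,
    ← (toggle j).tsum_eq (fun S => (if j ∈ S then TT a s S else 0)), tsum_congr h2, tsum_mul_left]
  ring

lemma tup_strictMono {m : ℕ} (k : Tup m) : StrictMono k.1 :=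
  Fin.strictMono_iff_lt_succ.2 fun i => by have := k.2 i; omega

/-- Tuples as finsets with fixed cardinality. -/
def tupSet (m : ℕ) (k : Tup m) : (Finset.card ⁻¹' {m + 1} : Set (Finset ℤ)) :=
  ⟨Finset.univ.image k.1, by
    simp [Finset.card_image_of_injective _ (tup_strictMono k).injective]⟩

lemma tupSet_inj (m : ℕ) : Function.Injective (tupSet m) := by
  intro k k' h
  have h' : Finset.univ.image k.1 = Finset.univ.image k'.1 := congrArg Subtype.val h
  apply Subtype.ext
  rw [← (tup_strictMono k).range_inj (tup_strictMono k')]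
  have := congrArg (fun S : Finset ℤ => (S : Set ℤ)) h'
  simpa using this

lemma FF_eq {x : ℤ → ℂ} (hx : Summable fun n => ‖x n * x (n + 1)‖) :
    FF x = PP (fun n => x n * x (n + 1)) Set.univ := by
  set a : ℤ → ℂ := fun n => x n * x (n + 1) with ha
  have h1 := (TT_summable hx Set.univ).hasSum.tsum_fiberwise Finset.card
  have h2 : PP a Set.univ = ∑' m, ∑' S : (Finset.card ⁻¹' {m} : Set (Finset ℤ)), TT a Set.univ S :=
    h1.tsum_eq.symm
  rw [h2, h1.summable.tsum_eq_zero_add]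
  unfold FF
  congr 1
  · rw [tsum_eq_single ⟨∅, by simp⟩]
    · simp [TT, Sparse]
    · rintro ⟨S, hS⟩ h
      exfalso; apply h
      simpa using hS
  · refine tsum_congr fun m => ?_
    rw [← (tupSet_inj m).tsum_eq, ← tsum_mul_left]
    · refine tsum_congr fun k => ?_
      have hinj := (tup_strictMono k).injective
      have hsp : Sparse (Finset.univ.image k.1) := by
        intro p hp hp'
        simp only [Finset.mem_image, Finset.mem_univ, true_and] at hp hp'
        obtain ⟨i, hi⟩ := hp
        obtain ⟨i', hi'⟩ := hp'
        have hlt : i < i' := (tup_strictMono k).lt_iff_lt.1 (by omega)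
        have hi0 : i.val < m := by have := i'.2; have : i.val < i'.val := hlt; omega
        have := k.2 ⟨i.val, hi0⟩
        have h3 : k.1 (Fin.succ ⟨i.val, hi0⟩) ≤ k.1 i' :=
          (tup_strictMono k).monotone (by rw [Fin.le_def]; simpa using hlt)
        have h4 : (Fin.castSucc ⟨i.val, hi0⟩ : Fin (m+1)) = i := by ext; simp
        rw [h4] at this
        omega
      unfold TT
      rw [if_pos ⟨hsp, fun _ _ => trivial⟩]
      show _ = ∏ p ∈ Finset.univ.image k.1, _
      rw [Finset.prod_image (fun _ _ _ _ h => hinj h)]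
      rw [Finset.prod_neg]
      simp [ha]
    · rintro ⟨S, hS⟩ hsup
      have hcard : S.card = m + 1 := hS
      have hsp : Sparse S := by
        by_contra hns
        apply hsup
        simp [TT, hns]
      refine ⟨⟨S.orderEmbOfFin hcard, fun j => ?_⟩, ?_⟩
      · have hlt : S.orderEmbOfFin hcard j.castSucc < S.orderEmbOfFin hcard j.succ :=
          (S.orderEmbOfFin hcard).strictMono (Fin.castSucc_lt_succ)
        have := hsp _ (S.orderEmbOfFin_mem hcard j.castSucc)
        have h5 : S.orderEmbOfFin hcard j.castSucc + 1 ≠ S.orderEmbOfFin hcard j.succ := by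
          intro e; rw [e] at this
          exact this (S.orderEmbOfFin_mem hcard _)
        omega
      · apply Subtype.ext
        simp [tupSet]

end Jacobi

namespace Jacobi

open ComplexConjugate

lemma core_step (D E u0 u1 u2 : ℂ) (v : ℝ) (hD : D ≠ 0) (hE : E ≠ 0)
    (h : u2 = u1 - (v : ℂ) ^ 2 / (E * D) * u0) :
    (D * u2 * conj u1).im = D.im * Complex.normSq u1 +
      v ^ 2 / Complex.normSq E * (E * u1 * conj u0).im := by
  have hn : (Complex.normSq E : ℂ) ≠ 0 := by
    exact_mod_cast (Complex.normSq_pos.2 hE).ne'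
  have hE' : conj E ≠ 0 := by simpa using hE
  have key : D * u2 * conj u1 = D * (Complex.normSq u1 : ℝ) -
      ((v ^ 2 / Complex.normSq E : ℝ) : ℂ) * conj (E * u1 * conj u0) := by
    push_cast
    rw [h, ← Complex.mul_conj, ← Complex.mul_conj]
    simp only [map_mul, Complex.conj_conj]
    field_simp
  rw [key, Complex.sub_im, Complex.im_mul_ofReal, Complex.im_ofReal_mul, Complex.conj_im]
  ring

lemma core (z : ℂ) (μ v : ℕ → ℝ) (hz : ∀ j, z - μ j ≠ 0) (u : ℕ → ℂ) (h0 : u 0 = 1) (h1 : u 1 = 1)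
    (h : ∀ j, u (j + 2) = u (j + 1) - (v j : ℂ) ^ 2 / ((z - μ j) * (z - μ (j + 1))) * u j) (j : ℕ) :
    z.im ^ 2 * Complex.normSq (u j) ≤ z.im * ((z - μ j) * u (j + 1) * conj (u j)).im := by
  induction j with
  | zero => simp [h0, h1, sq]
  | succ j ih =>
    rw [core_step _ _ _ _ _ _ (hz (j + 1)) (hz j) (h j)]
    have hb : 0 ≤ v j ^ 2 / Complex.normSq (z - μ j) :=
      div_nonneg (sq_nonneg _) (Complex.normSq_nonneg _)
    have h2 : 0 ≤ z.im * ((z - μ j) * u (j + 1) * conj (u j)).im :=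
      le_trans (mul_nonneg (sq_nonneg _) (Complex.normSq_nonneg _)) ih
    have h3 := mul_nonneg hb h2
    have h4 : (z - (μ (j + 1) : ℂ)).im = z.im := by simp
    rw [h4]
    nlinarith

/-- The basic coefficient. -/
def aa (lam w : ℤ → ℝ) (z : ℂ) (n : ℤ) : ℂ :=
  (w n : ℂ) ^ 2 / ((z - lam n) * (z - lam (n + 1)))

section
variable {lam w : ℤ → ℝ} {z : ℂ}

lemma p_rec (ha : Summable fun n => ‖aa lam w z n‖) (n : ℤ) :
    PP (aa lam w z) (Set.Ici n) = PP (aa lam w z) (Set.Ici (n + 1)) -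
      aa lam w z n * PP (aa lam w z) (Set.Ici (n + 2)) := by
  apply PP_rec ha (j := n) <;> simp only [Set.mem_Ici] <;> intros <;> omega

lemma q_rec (ha : Summable fun n => ‖aa lam w z n‖) (n : ℤ) :
    PP (aa lam w z) (Set.Iio n) = PP (aa lam w z) (Set.Iio (n - 1)) -
      aa lam w z (n - 1) * PP (aa lam w z) (Set.Iio (n - 2)) := by
  apply PP_rec ha (j := n - 1) <;> simp only [Set.mem_Iio] <;> intros <;> omega

lemma p_ineq (hz : ∀ n, z - lam n ≠ 0) (ha : Summable fun n => ‖aa lam w z n‖) (n : ℤ) :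
    z.im ^ 2 * Complex.normSq (PP (aa lam w z) (Set.Ici (n + 1))) ≤
      z.im * ((z - lam n) * PP (aa lam w z) (Set.Ici n) *
        conj (PP (aa lam w z) (Set.Ici (n + 1)))).im := by
  have hfin : ∀ N : ℤ, n ≤ N →
    z.im ^ 2 * Complex.normSq (PP (aa lam w z) (Set.Ico (n + 1) N)) ≤
      z.im * ((z - lam n) * PP (aa lam w z) (Set.Ico n N) *
        conj (PP (aa lam w z) (Set.Ico (n + 1) N))).im := by
    intro N hN
    have := core z (fun j => lam (N - j)) (fun j => w (N - 1 - j)) (fun j => hz _)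
      (fun j => PP (aa lam w z) (Set.Ico (N + 1 - j) N))
      (by simp [PP_empty]) (by simp [PP_empty])
      (fun j => by
        have e := PP_rec ha (s := Set.Ico (N - 1 - j) N) (t := Set.Ico (N - j) N)
          (u := Set.Ico (N + 1 - j) N) (j := N - 1 - j)
          (by simp only [Set.mem_Ico]; omega) (by simp only [Set.mem_Ico]; omega)
          (by simp only [Set.mem_Ico]; omega)
        have e1 : N + 1 - ((j + 2 : ℕ) : ℤ) = N - 1 - j := by push_cast; ring
        have e2 : N + 1 - ((j + 1 : ℕ) : ℤ) = N - j := by push_cast; ring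
        have e3 : N - ((j + 1 : ℕ) : ℤ) = N - 1 - j := by push_cast; ring
        simp only [e1, e2, e3]
        rw [e, aa]
        have e4 : N - 1 - (j : ℤ) + 1 = N - j := by ring
        rw [e4, mul_comm (z - (lam (N - j) : ℂ))]) (N - n).toNat
    have e0 : (((N - n).toNat : ℕ) : ℤ) = N - n := by omega
    have e1 : N + 1 - (((N - n).toNat : ℕ) : ℤ) = n + 1 := by omega
    have e2 : N + 1 - (((N - n).toNat + 1 : ℕ) : ℤ) = n := by omega
    have e3 : N - (((N - n).toNat : ℕ) : ℤ) = n := by omega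
    simpa only [e1, e2, e3] using this
  have t : ∀ m : ℤ, Tendsto (fun N : ℤ => PP (aa lam w z) (Set.Ico m N)) atTop
      (𝓝 (PP (aa lam w z) (Set.Ici m))) := fun m => by
    apply PP_tendsto ha
    intro k
    filter_upwards [eventually_gt_atTop k] with N hN
    simp [hN]
  refine le_of_tendsto_of_tendsto ?_ ?_ ((eventually_ge_atTop n).mono hfin)
  · exact ((Complex.continuous_normSq.tendsto _).comp (t (n + 1))).const_mul _
  · refine Tendsto.const_mul _ ((Complex.continuous_im.tendsto _).comp ?_)
    exact ((t n).const_mul _).mul ((Complex.continuous_conj.tendsto _).comp (t (n + 1)))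

lemma q_ineq (hz : ∀ n, z - lam n ≠ 0) (ha : Summable fun n => ‖aa lam w z n‖) (n : ℤ) :
    z.im ^ 2 * Complex.normSq (PP (aa lam w z) (Set.Iio (n - 1))) ≤
      z.im * ((z - lam n) * PP (aa lam w z) (Set.Iio n) *
        conj (PP (aa lam w z) (Set.Iio (n - 1)))).im := by
  have hfin : ∀ N : ℤ, N ≤ n →
    z.im ^ 2 * Complex.normSq (PP (aa lam w z) (Set.Ico N (n - 1))) ≤
      z.im * ((z - lam n) * PP (aa lam w z) (Set.Ico N n) *
        conj (PP (aa lam w z) (Set.Ico N (n - 1)))).im := by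
    intro N hN
    have := core z (fun j => lam (N + j)) (fun j => w (N + j)) (fun j => hz _)
      (fun j => PP (aa lam w z) (Set.Ico N (N - 1 + j)))
      (by simp [PP_empty]) (by simp [PP_empty])
      (fun j => by
        have e := PP_rec ha (s := Set.Ico N (N + 1 + j)) (t := Set.Ico N (N + j))
          (u := Set.Ico N (N - 1 + j)) (j := N + j)
          (by simp only [Set.mem_Ico]; omega) (by simp only [Set.mem_Ico]; omega)
          (by simp only [Set.mem_Ico]; omega)
        have e1 : N - 1 + ((j + 2 : ℕ) : ℤ) = N + 1 + j := by push_cast; ring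
        have e2 : N - 1 + ((j + 1 : ℕ) : ℤ) = N + j := by push_cast; ring
        have e3 : N + ((j + 1 : ℕ) : ℤ) = N + j + 1 := by push_cast; ring
        simp only [e1, e2, e3]
        rw [e, aa]) (n - N).toNat
    have e1 : N - 1 + (((n - N).toNat : ℕ) : ℤ) = n - 1 := by omega
    have e2 : N - 1 + (((n - N).toNat + 1 : ℕ) : ℤ) = n := by omega
    have e3 : N + (((n - N).toNat : ℕ) : ℤ) = n := by omega
    simpa only [e1, e2, e3] using this
  have t : ∀ m : ℤ, Tendsto (fun N : ℤ => PP (aa lam w z) (Set.Ico N m)) atBot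
      (𝓝 (PP (aa lam w z) (Set.Iio m))) := fun m => by
    apply PP_tendsto ha
    intro k
    filter_upwards [eventually_le_atBot k] with N hN
    simp [hN]
  refine le_of_tendsto_of_tendsto ?_ ?_ ((eventually_le_atBot n).mono hfin)
  · exact ((Complex.continuous_normSq.tendsto _).comp (t (n - 1))).const_mul _
  · refine Tendsto.const_mul _ ((Complex.continuous_im.tendsto _).comp ?_)
    exact ((t n).const_mul _).mul ((Complex.continuous_conj.tendsto _).comp (t (n - 1)))

lemma p_tendsto_top (ha : Summable fun n => ‖aa lam w z n‖) :
    Tendsto (fun n : ℤ => PP (aa lam w z) (Set.Ici n)) atTop (𝓝 1) := by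
  rw [← PP_empty (aa lam w z)]
  apply PP_tendsto ha
  intro k
  filter_upwards [eventually_gt_atTop k] with N hN
  simp [hN]

lemma p_tendsto_bot (ha : Summable fun n => ‖aa lam w z n‖) :
    Tendsto (fun n : ℤ => PP (aa lam w z) (Set.Ici n)) atBot (𝓝 (PP (aa lam w z) Set.univ)) := by
  apply PP_tendsto ha
  intro k
  filter_upwards [eventually_le_atBot k] with N hN
  simp [hN]

lemma q_tendsto_bot (ha : Summable fun n => ‖aa lam w z n‖) :
    Tendsto (fun n : ℤ => PP (aa lam w z) (Set.Iio n)) atBot (𝓝 1) := by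
  rw [← PP_empty (aa lam w z)]
  apply PP_tendsto ha
  intro k
  filter_upwards [eventually_le_atBot k] with N hN
  simp [hN]

lemma split (ha : Summable fun n => ‖aa lam w z n‖) (n : ℤ) :
    PP (aa lam w z) Set.univ =
      PP (aa lam w z) (Set.Ici n) * PP (aa lam w z) (Set.Iio (n - 1)) -
      aa lam w z (n - 1) * PP (aa lam w z) (Set.Ici (n + 1)) * PP (aa lam w z) (Set.Iio (n - 2)) := by
  set V : ℤ → ℂ := fun n =>
      PP (aa lam w z) (Set.Ici n) * PP (aa lam w z) (Set.Iio (n - 1)) -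
      aa lam w z (n - 1) * PP (aa lam w z) (Set.Ici (n + 1)) * PP (aa lam w z) (Set.Iio (n - 2))
    with hV
  have hstep : ∀ m, V (m + 1) = V m := by
    intro m
    simp only [hV]
    have e1 : m + 1 - 1 = m := by ring
    have e2 : m + 1 + 1 = m + 2 := by ring
    have e3 : m + 1 - 2 = m - 1 := by ring
    rw [e1, e2, e3, p_rec ha m, q_rec ha m]
    ring
  have hconst : ∀ m, V m = V n := by
    intro m
    have hup : ∀ (m : ℤ) (k : ℕ), V (m + k) = V m := by
      intro m k
      induction k with
      | zero => simp
      | succ k ih =>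
        rw [← ih, ← hstep (m + k)]
        congr 1; push_cast; ring
    rcases le_total m n with h | h
    · rw [← hup m (n - m).toNat]
      congr 1; omega
    · rw [← hup n (m - n).toNat]
      congr 1; omega
  have ht : Tendsto V atBot (𝓝 (PP (aa lam w z) Set.univ * 1 - 0 * PP (aa lam w z) Set.univ * 1)) := by
    have sh : ∀ c : ℤ, Tendsto (fun m : ℤ => m + c) atBot atBot := fun c =>
      tendsto_atBot_add_const_right _ c tendsto_id
    have ha0 : Tendsto (aa lam w z) atBot (𝓝 0) := by
      have := (summable_norm_iff.1 ha).tendsto_cofinite_zero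
      rw [Int.cofinite_eq] at this
      exact this.mono_left le_sup_left
    refine Tendsto.sub ((p_tendsto_bot ha).mul ((q_tendsto_bot ha).comp (sh (-1)))) ?_
    exact ((ha0.comp (sh (-1))).mul ((p_tendsto_bot ha).comp (sh 1))).mul
      ((q_tendsto_bot ha).comp (sh (-2)))
  have ht2 : Tendsto V atBot (𝓝 (V n)) := by
    have : V = fun _ => V n := funext hconst
    rw [this]; exact tendsto_const_nhds
  have := tendsto_nhds_unique ht ht2
  simpa using this

lemma final_ineq (hz : ∀ n, z - lam n ≠ 0) (ha : Summable fun n => ‖aa lam w z n‖) (n : ℤ) :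
    |z.im| * ‖PP (aa lam w z) (Set.Ici (n + 1)) * PP (aa lam w z) (Set.Iio (n - 1))‖ ≤
      ‖z - lam n‖ * ‖PP (aa lam w z) Set.univ‖ := by
  have h1 := p_ineq hz ha n
  have h2 := q_ineq hz ha (n - 1)
  have h3 := split ha n
  have e2 : n - 1 - 1 = n - 2 := by ring
  rw [e2] at h2
  rw [aa, sub_add_cancel] at h3
  generalize PP (aa lam w z) Set.univ = F at *
  generalize PP (aa lam w z) (Set.Ici n) = p at *
  generalize PP (aa lam w z) (Set.Ici (n + 1)) = p' at *
  generalize PP (aa lam w z) (Set.Iio (n - 1)) = q at *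
  generalize PP (aa lam w z) (Set.Iio (n - 2)) = q' at *
  have hD := hz n
  have hE := hz (n - 1)
  generalize hDd : z - (lam n : ℂ) = D at *
  generalize hEd : z - (lam (n - 1) : ℂ) = E at *
  generalize w (n - 1) = v at *
  have hn : (Complex.normSq E : ℂ) ≠ 0 := by
    exact_mod_cast (Complex.normSq_pos.2 hE).ne'
  have hE' : conj E ≠ 0 := by simpa using hE
  have key : D * F * conj (p' * q) = D * p * conj p' * (Complex.normSq q : ℝ) -
      ((Complex.normSq p' * (v ^ 2 / Complex.normSq E) : ℝ) : ℂ) * conj (E * q * conj q') := by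
    push_cast
    rw [h3, ← Complex.mul_conj, ← Complex.mul_conj, ← Complex.mul_conj]
    simp only [map_mul, Complex.conj_conj]
    field_simp
  have him : (D * F * conj (p' * q)).im = (D * p * conj p').im * Complex.normSq q +
      Complex.normSq p' * (v ^ 2 / Complex.normSq E) * (E * q * conj q').im := by
    rw [key, Complex.sub_im, Complex.im_mul_ofReal, Complex.im_ofReal_mul, Complex.conj_im]
    ring
  have hb : 0 ≤ Complex.normSq p' * (v ^ 2 / Complex.normSq E) :=
    mul_nonneg (Complex.normSq_nonneg _) (div_nonneg (sq_nonneg _) (Complex.normSq_nonneg _))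
  have h4 : 0 ≤ z.im * (E * q * conj q').im :=
    le_trans (mul_nonneg (sq_nonneg _) (Complex.normSq_nonneg _)) h2
  have h5 := mul_nonneg hb h4
  have h6 := mul_le_mul_of_nonneg_right h1 (Complex.normSq_nonneg q)
  have h7 : z.im ^ 2 * ‖p' * q‖ ^ 2 ≤ z.im * (D * F * conj (p' * q)).im := by
    rw [him, ← Complex.normSq_eq_norm_sq, Complex.normSq_mul]
    linarith
  have h8 : z.im * (D * F * conj (p' * q)).im ≤ |z.im| * (‖D‖ * ‖F‖ * ‖p' * q‖) := by
    refine (le_abs_self _).trans ?_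
    rw [abs_mul]
    refine mul_le_mul_of_nonneg_left ((Complex.abs_im_le_norm _).trans ?_) (abs_nonneg _)
    rw [norm_mul, norm_mul, RCLike.norm_conj]
  have h9 := h7.trans h8
  rw [← sq_abs z.im] at h9
  by_contra hlt
  push Not at hlt
  have hpos : 0 < |z.im| * ‖p' * q‖ := lt_of_le_of_lt (by positivity) hlt
  nlinarith

lemma exists_ne (hw : ∀ n, w n ≠ 0) (hz : ∀ n, z - lam n ≠ 0)
    (ha : Summable fun n => ‖aa lam w z n‖) :
    ∃ n : ℤ, PP (aa lam w z) (Set.Ici (n + 1)) * PP (aa lam w z) (Set.Iio (n - 1)) ≠ 0 := by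
  by_contra hcon
  push Not at hcon
  have hane : ∀ n, aa lam w z n ≠ 0 := fun n =>
    div_ne_zero (pow_ne_zero _ (by exact_mod_cast hw n)) (mul_ne_zero (hz _) (hz _))
  have h1 := (p_tendsto_top ha).eventually_ne one_ne_zero
  obtain ⟨M, hM⟩ := eventually_atTop.1 h1
  have hq : ∀ m, M ≤ m → PP (aa lam w z) (Set.Iio m) = 0 := by
    intro m hm
    have := hcon (m + 1)
    rw [add_sub_cancel_right] at this
    exact (mul_eq_zero.1 this).resolve_left (hM _ (by omega))
  have hall : ∀ k : ℕ, PP (aa lam w z) (Set.Iio (M - k)) = 0 ∧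
      PP (aa lam w z) (Set.Iio (M - k + 1)) = 0 := by
    intro k
    induction k with
    | zero => exact ⟨hq _ (by simp), hq _ (by simp)⟩
    | succ k ih =>
      have e := q_rec ha (M - k + 1)
      have e1 : M - k + 1 - 1 = M - k := by ring
      have e2 : M - k + 1 - 2 = M - ((k + 1 : ℕ) : ℤ) := by push_cast; ring
      have e3 : M - ((k + 1 : ℕ) : ℤ) + 1 = M - k := by push_cast; ring
      rw [e1, e2, ih.1, ih.2] at e
      rw [e3]
      refine ⟨?_, ih.1⟩
      have : aa lam w z (M - k) * PP (aa lam w z) (Set.Iio (M - ((k + 1 : ℕ) : ℤ))) = 0 := by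
        linear_combination e
      exact (mul_eq_zero.1 this).resolve_left (hane _)
  obtain ⟨L, hL⟩ := eventually_atBot.1 ((q_tendsto_bot ha).eventually_ne one_ne_zero)
  refine hL (M - ((M - L).toNat : ℕ)) (by omega) (hall _).1

end

lemma local_bound {lam w : ℤ → ℝ}
    (hconv : ConvCond (fun n => (lam n : ℂ)) (fun n => (w n : ℂ))) {z₁ : ℂ}
    (h1 : z₁ ∈ C0 fun n => (lam n : ℂ)) :
    ∃ d > 0, ∃ b : ℤ → ℝ, Summable b ∧ ∀ z ∈ Metric.ball z₁ d, ∀ n,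
      z - lam n ≠ 0 ∧ ‖aa lam w z n‖ ≤ b n := by
  obtain ⟨c, hc, hsum⟩ := hconv
  have hopen : IsOpen (C0 fun n => (lam n : ℂ)) := isClosed_closure.isOpen_compl
  obtain ⟨r, hr, hball⟩ := Metric.isOpen_iff.1 hopen z₁ h1
  have hmem : ∀ n, (lam n : ℂ) ∉ C0 fun n => (lam n : ℂ) := fun n h =>
    h (subset_closure ⟨n, rfl⟩)
  have hcn : ∀ n, (lam n : ℂ) - c ≠ 0 := fun n h => by
    apply hmem n
    have : (lam n : ℂ) = c := sub_eq_zero.1 h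
    rw [this]; exact hc
  set C : ℝ := 1 + (r / 2 + ‖z₁ - c‖) / (r / 2) with hC
  refine ⟨r / 2, by positivity, fun n => C ^ 2 *
    ‖(w n : ℂ) ^ 2 / (((lam n : ℂ) - c) * ((lam (n + 1) : ℂ) - c))‖, hsum.mul_left _, ?_⟩
  intro z hz n
  have hdist : ∀ n, r / 2 ≤ ‖z - lam n‖ := by
    intro n
    by_contra hlt
    push Not at hlt
    apply hmem n
    apply hball
    rw [Metric.mem_ball, dist_eq_norm] at *
    have : (lam n : ℂ) - z₁ = -(z - lam n) + (z - z₁) := by ring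
    rw [this]
    refine (norm_add_le _ _).trans_lt ?_
    rw [norm_neg]; linarith
  have hpos : ∀ n, 0 < ‖z - lam n‖ := fun n => lt_of_lt_of_le (by positivity) (hdist n)
  have hCpos : 0 < C := by positivity
  have hle : ∀ n, ‖(lam n : ℂ) - c‖ ≤ C * ‖z - lam n‖ := by
    intro n
    have h2 : (lam n : ℂ) - c = -(z - lam n) + ((z - z₁) + (z₁ - c)) := by ring
    have h3 : ‖(lam n : ℂ) - c‖ ≤ ‖z - lam n‖ + (‖z - z₁‖ + ‖z₁ - c‖) := by
      rw [h2]
      refine (norm_add_le _ _).trans ?_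
      rw [norm_neg]
      gcongr
      exact norm_add_le _ _
    rw [Metric.mem_ball, dist_eq_norm] at hz
    have h4 : r / 2 + ‖z₁ - c‖ ≤ (r / 2 + ‖z₁ - c‖) / (r / 2) * ‖z - lam n‖ := by
      rw [div_mul_eq_mul_div, le_div_iff₀ (by positivity)]
      gcongr
      exact hdist n
    rw [hC]
    linarith
  have hinv : ∀ n, 1 / ‖z - lam n‖ ≤ C * (1 / ‖(lam n : ℂ) - c‖) := by
    intro n
    rw [mul_one_div, div_le_div_iff₀ (hpos n) (norm_pos_iff.2 (hcn n)), one_mul]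
    exact hle n
  refine ⟨norm_pos_iff.1 (hpos n), ?_⟩
  beta_reduce
  rw [aa, norm_div, norm_div, norm_mul, norm_mul]
  calc ‖(w n : ℂ) ^ 2‖ / (‖z - lam n‖ * ‖z - lam (n + 1)‖)
      = ‖(w n : ℂ) ^ 2‖ * ((1 / ‖z - lam n‖) * (1 / ‖z - lam (n + 1)‖)) := by
        rw [one_div_mul_one_div, mul_one_div]
    _ ≤ ‖(w n : ℂ) ^ 2‖ * ((C * (1 / ‖(lam n : ℂ) - c‖)) * (C * (1 / ‖(lam (n + 1) : ℂ) - c‖))) := by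
        gcongr
        · exact hinv n
        · exact hinv (n + 1)
    _ = _ := by ring

lemma PP_diff {lam w : ℤ → ℝ}
    (hconv : ConvCond (fun n => (lam n : ℂ)) (fun n => (w n : ℂ))) {z₁ : ℂ}
    (h1 : z₁ ∈ C0 fun n => (lam n : ℂ)) (s : Set ℤ) :
    DifferentiableAt ℂ (fun z => PP (aa lam w z) s) z₁ := by
  obtain ⟨d, hd, b, hb, hball⟩ := local_bound hconv h1
  have hb0 : ∀ n, 0 ≤ b n := fun n =>
    (norm_nonneg _).trans (hball z₁ (Metric.mem_ball_self hd) n).2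
  have : DifferentiableOn ℂ (fun z => PP (aa lam w z) s) (Metric.ball z₁ d) := by
    unfold PP
    refine Complex.differentiableOn_tsum_of_summable_norm
      (summable_finsetProd_of_summable_nonneg hb0 hb) ?_ Metric.isOpen_ball ?_
    · intro S
      unfold TT
      split_ifs
      · intro z hz
        refine DifferentiableAt.differentiableWithinAt ?_
        refine DifferentiableAt.fun_finsetProd fun k _ => ?_
        refine DifferentiableAt.neg ?_
        unfold aa
        refine DifferentiableAt.div (by fun_prop) (by fun_prop)
          (mul_ne_zero (hball z hz _).1 (hball z hz _).1)
      · exact differentiableOn_const _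
    · intro S z hz
      exact (TT_norm_le _ _ _).trans
        (Finset.prod_le_prod (fun _ _ => norm_nonneg _) fun k _ => (hball z hz k).2)
  exact this.differentiableAt (Metric.ball_mem_nhds _ hd)

lemma basic {lam w : ℤ → ℝ}
    (hconv : ConvCond (fun n => (lam n : ℂ)) (fun n => (w n : ℂ))) {z : ℂ}
    (h1 : z ∈ C0 fun n => (lam n : ℂ)) :
    (∀ n, z - lam n ≠ 0) ∧ Summable fun n => ‖aa lam w z n‖ := by
  obtain ⟨d, hd, b, hb, hball⟩ := local_bound hconv h1
  have := hball z (Metric.mem_ball_self hd)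
  exact ⟨fun n => (this n).1, hb.of_nonneg_of_le (fun _ => norm_nonneg _) fun n => (this n).2⟩

lemma charF_eq {lam w : ℤ → ℝ} {γ : ℤ → ℂ} (hγ : ∀ n, γ n * γ (n + 1) = (w n : ℂ))
    (hconv : ConvCond (fun n => (lam n : ℂ)) (fun n => (w n : ℂ))) {z : ℂ}
    (h1 : z ∈ C0 fun n => (lam n : ℂ)) :
    charF (fun n => (lam n : ℂ)) γ z = PP (aa lam w z) Set.univ := by
  have e : (fun n => γ n ^ 2 / (z - lam n) * (γ (n + 1) ^ 2 / (z - lam (n + 1)))) = aa lam w z := by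
    funext n
    rw [aa, ← hγ, div_mul_div_comm]
    ring
  unfold charF
  rw [FF_eq]
  · rw [e]
  · have := (basic hconv h1).2
    rw [← e] at this
    exact this

end Jacobi

/-- for real `λ` and `w` with `der(λ) ≠ ℝ`, all zeros of `F_𝒥` in `ℂ₀^λ`
are real and simple. -/
theorem statement16 (lam w : ℤ → ℝ) (hw : ∀ n, w n ≠ 0) (γ : ℤ → ℂ)
    (hγ : ∀ n, γ n * γ (n + 1) = (w n : ℂ))
    (hconv : Jacobi.ConvCond (fun n => (lam n : ℂ)) (fun n => (w n : ℂ)))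
    (hder : {x : ℝ | (x : ℂ) ∈ Jacobi.der fun n => (lam n : ℂ)} ≠ Set.univ)
    (z₀ : ℂ) (hz : z₀ ∈ Jacobi.C0 fun n => (lam n : ℂ))
    (h0 : Jacobi.charF (fun n => (lam n : ℂ)) γ z₀ = 0) :
    z₀.im = 0 ∧ deriv (Jacobi.charF (fun n => (lam n : ℂ)) γ) z₀ ≠ 0 := by
  have hopen : IsOpen (Jacobi.C0 fun n => (lam n : ℂ)) := isClosed_closure.isOpen_compl
  obtain ⟨hz1, ha⟩ := Jacobi.basic hconv hz
  obtain ⟨n, hn⟩ := Jacobi.exists_ne hw hz1 ha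
  have him : z₀.im = 0 := by
    by_contra hne
    have h1 := Jacobi.final_ineq hz1 ha n
    rw [← Jacobi.charF_eq hγ hconv hz, h0, norm_zero, mul_zero] at h1
    have : 0 < |z₀.im| * ‖Jacobi.PP (Jacobi.aa lam w z₀) (Set.Ici (n + 1)) *
        Jacobi.PP (Jacobi.aa lam w z₀) (Set.Iio (n - 1))‖ :=
      mul_pos (abs_pos.2 hne) (norm_pos_iff.2 hn)
    linarith
  refine ⟨him, fun hd => hn ?_⟩
  have hC0 : ∀ᶠ z in 𝓝 z₀, z ∈ Jacobi.C0 fun n => (lam n : ℂ) := hopen.mem_nhds hz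
  have hdiff : DifferentiableAt ℂ (Jacobi.charF (fun n => (lam n : ℂ)) γ) z₀ :=
    (Jacobi.PP_diff hconv hz Set.univ).congr_of_eventuallyEq
      (hC0.mono fun z hz' => Jacobi.charF_eq hγ hconv hz')
  have hslope := hdiff.hasDerivAt
  rw [hd, hasDerivAt_iff_tendsto_slope] at hslope
  have hpath : Tendsto (fun y : ℝ => z₀ + y * Complex.I) (𝓝[≠] 0) (𝓝[≠] z₀) := by
    refine tendsto_nhdsWithin_iff.2 ⟨?_, ?_⟩
    · have : Continuous fun y : ℝ => z₀ + y * Complex.I := by fun_prop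
      have h := (this.tendsto 0).mono_left (nhdsWithin_le_nhds (s := {0}ᶜ))
      simpa using h
    · filter_upwards [self_mem_nhdsWithin] with y hy
      simpa using hy
  have hpath' := hpath.mono_right nhdsWithin_le_nhds
  have hlim : Tendsto (fun y : ℝ => ‖(z₀ + y * Complex.I) - lam n‖ *
      ‖slope (Jacobi.charF (fun n => (lam n : ℂ)) γ) z₀ (z₀ + y * Complex.I)‖) (𝓝[≠] 0)
      (𝓝 (‖z₀ - lam n‖ * ‖(0 : ℂ)‖)) :=
    (hpath'.sub_const _).norm.mul (hslope.comp hpath).norm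
  have hcont : Tendsto (fun y : ℝ =>
      ‖Jacobi.PP (Jacobi.aa lam w (z₀ + y * Complex.I)) (Set.Ici (n + 1)) *
        Jacobi.PP (Jacobi.aa lam w (z₀ + y * Complex.I)) (Set.Iio (n - 1))‖) (𝓝[≠] 0)
      (𝓝 ‖Jacobi.PP (Jacobi.aa lam w z₀) (Set.Ici (n + 1)) *
        Jacobi.PP (Jacobi.aa lam w z₀) (Set.Iio (n - 1))‖) :=
    (((Jacobi.PP_diff hconv hz (Set.Ici (n + 1))).continuousAt.tendsto.comp hpath').mul
      ((Jacobi.PP_diff hconv hz (Set.Iio (n - 1))).continuousAt.tendsto.comp hpath')).norm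
  have hle := le_of_tendsto_of_tendsto hcont hlim (by
    filter_upwards [hpath'.eventually hC0, self_mem_nhdsWithin] with y hy hy0
    obtain ⟨hz2, ha2⟩ := Jacobi.basic hconv hy
    have h1 := Jacobi.final_ineq hz2 ha2 n
    have hyim : (z₀ + y * Complex.I).im = y := by simp [him]
    have hypos : 0 < |y| := abs_pos.2 hy0
    rw [hyim, ← Jacobi.charF_eq hγ hconv hy] at h1
    have hyI : ‖(y : ℂ) * Complex.I‖ = |y| := by simp
    rw [slope_def_field, h0, sub_zero, add_sub_cancel_left, norm_div, hyI, ← mul_div_assoc, le_div_iff₀ hypos]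
    linarith)
  rw [norm_zero, mul_zero] at hle
  exact norm_le_zero_iff.1 hle

end
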